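/- Let M be a topological manifold of dimension n ≥ 2 and let X ⊆ M be a closed subset which has dimension zero. Then the inclusion M ∖ X → M induces a bijection on sets of connected components (equivalently, an isomorphism H₀(M ∖ X; ℤ) → H₀(M; ℤ)). -/

import Mathlib

/-- A space is locally Euclidean of dimension `n` if every point has an open neighborhood
homeomorphic to an open subset of `ℝⁿ`. -/
def IsLocallyEuclidean (n : ℕ) (X : Type) [TopologicalSpace X] : Prop :=
  ∀ x : X, ∃ (U : Set X) (V : Set (EuclideanSpace ℝ (Fin n))),
    x ∈ U ∧ IsOpen U ∧ IsOpen V ∧ Nonempty (U ≃ₜ V)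

/-- A topological space has dimension zero if every point has arbitrarily small clopen
neighborhoods. -/
def HasDimensionZero (X : Type) [TopologicalSpace X] : Prop :=
  ∀ (x : X) (U : Set X), IsOpen U → x ∈ U → ∃ V : Set X, IsOpen V ∧ IsClosed V ∧ x ∈ V ∧ V ⊆ U

/-- The map on connected components induced by the inclusion `M ∖ X → M`. -/
noncomputable def complComponentsMap (M : Type) [TopologicalSpace M] (X : Set M) :
    ConnectedComponents (Xᶜ : Set M) → ConnectedComponents M :=
  Continuous.connectedComponentsLift
    ((ConnectedComponents.continuous_coe : Continuous (ConnectedComponents.mk (α := M))).comp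
      continuous_subtype_val)

open Set Filter Topology

/-- `u` and `v` lie in a common connected subset of the complement of `C`. -/
def NonSep {E : Type*} [TopologicalSpace E] (u v : E) (C : Set E) : Prop :=
  ∃ t : Set E, IsPreconnected t ∧ u ∈ t ∧ v ∈ t ∧ t ⊆ Cᶜ

lemma continuousAt_indicator_aux {E : Type*} [TopologicalSpace E] {U V : Set E}
    (hU : IsOpen U) (hV : IsOpen V) (hUV : Disjoint U V) {h : E → ℝ} (hh : Continuous h) {y : E}
    (hy : y ∈ U ∨ y ∈ V ∨ h y = 0) : ContinuousAt (U.indicator h) y := by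
  rcases hy with hy | hy | hy
  · refine hh.continuousAt.congr ?_
    filter_upwards [hU.mem_nhds hy] with z hz
    rw [indicator_of_mem hz]
  · refine (continuousAt_const (y := (0 : ℝ))).congr ?_
    filter_upwards [hV.mem_nhds hy] with z hz
    rw [indicator_of_notMem (fun h' => hUV.le_bot ⟨h', hz⟩)]
  · have h0 : U.indicator h y = 0 := by
      by_cases hyU : y ∈ U
      · rw [indicator_of_mem hyU, hy]
      · rw [indicator_of_notMem hyU]
    rw [ContinuousAt, h0]
    have h1 : Tendsto (fun z => |h z|) (𝓝 y) (𝓝 0) := by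
      have := (hh.abs).tendsto y
      simpa [hy] using this
    refine squeeze_zero_norm (fun z => ?_) h1
    exact norm_indicator_le_norm_self h z

/-- Janiszewski's theorem. -/
lemma janiszewski {E : Type*} [TopologicalSpace E] [NormalSpace E] [SimplyConnectedSpace E]
    [LocallyPathConnectedSpace E] {K L : Set E} (hK : IsClosed K) (hL : IsClosed L)
    (hKL : Disjoint K L) {u v : E} (huK : NonSep u v K) (huL : NonSep u v L) :
    NonSep u v (K ∪ L) := by
  by_contra hns
  obtain ⟨tK, htK, utK, vtK, tKs⟩ := huK
  obtain ⟨tL, htL, utL, vtL, tLs⟩ := huL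
  have hu : u ∈ (K ∪ L)ᶜ := by
    rintro (h | h)
    · exact tKs utK h
    · exact tLs utL h
  have hv : v ∈ (K ∪ L)ᶜ := by
    rintro (h | h)
    · exact tKs vtK h
    · exact tLs vtL h
  have hO : IsOpen (K ∪ L)ᶜ := (hK.union hL).isOpen_compl
  set U := connectedComponentIn (K ∪ L)ᶜ u with hUdef
  have hU : IsOpen U := hO.connectedComponentIn
  have huU : u ∈ U := mem_connectedComponentIn hu
  have hvU : v ∉ U := fun h => hns ⟨U, isPreconnected_connectedComponentIn, huU, h,
    connectedComponentIn_subset _ _⟩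
  set V := (K ∪ L)ᶜ \ U with hVdef
  have hV : IsOpen V := by
    rw [isOpen_iff_mem_nhds]
    rintro z ⟨hz, hzU⟩
    refine mem_of_superset ((hO.connectedComponentIn (x := z)).mem_nhds
      (mem_connectedComponentIn hz)) ?_
    intro w hw
    refine ⟨connectedComponentIn_subset _ _ hw, fun hwU => hzU ?_⟩
    rw [hUdef, connectedComponentIn_eq hwU, ← connectedComponentIn_eq hw]
    exact mem_connectedComponentIn hz
  have hUV : Disjoint U V := disjoint_sdiff_right
  obtain ⟨f, hf0, hf1, -⟩ := exists_continuous_zero_one_of_isClosed hK hL hKL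
  set φ : E → ℝ := U.indicator f with hφ
  set ψ : E → ℝ := U.indicator (fun z => f z - 1) with hψ
  have cover : ∀ z, z ∈ U ∨ z ∈ V ∨ z ∈ K ∨ z ∈ L := by
    intro z
    by_cases h1 : z ∈ U
    · exact Or.inl h1
    · by_cases h2 : z ∈ K ∪ L
      · exact Or.inr (Or.inr h2)
      · exact Or.inr (Or.inl ⟨h2, h1⟩)
  have cφ : ∀ z, z ∉ L → ContinuousAt φ z := by
    intro z hz
    apply continuousAt_indicator_aux hU hV hUV f.continuous
    rcases cover z with h | h | h | h
    · exact Or.inl h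
    · exact Or.inr (Or.inl h)
    · exact Or.inr (Or.inr (hf0 h))
    · exact absurd h hz
  have cψ : ∀ z, z ∉ K → ContinuousAt ψ z := by
    intro z hz
    apply continuousAt_indicator_aux hU hV hUV (f.continuous.sub continuous_const)
    rcases cover z with h | h | h | h
    · exact Or.inl h
    · exact Or.inr (Or.inl h)
    · exact absurd h hz
    · refine Or.inr (Or.inr ?_)
      have : f z = 1 := hf1 h
      simp [this]
  have hφψ : ∀ z, (φ z : AddCircle (1 : ℝ)) = (ψ z : AddCircle (1 : ℝ)) := by
    intro z
    by_cases hz : z ∈ U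
    · simp only [hφ, hψ, indicator_of_mem hz]
      rw [AddCircle.coe_sub, AddCircle.coe_period, sub_zero]
    · simp only [hφ, hψ, indicator_of_notMem hz]
  have cg : Continuous (fun z => (φ z : AddCircle (1 : ℝ))) := by
    rw [continuous_iff_continuousAt]
    intro z
    by_cases hz : z ∈ L
    · have hzK : z ∉ K := fun h => hKL.le_bot ⟨h, hz⟩
      simp_rw [hφψ]
      exact (AddCircle.continuous_mk' (1 : ℝ)).continuousAt.comp (cψ z hzK)
    · exact (AddCircle.continuous_mk' (1 : ℝ)).continuousAt.comp (cφ z hz)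
  obtain ⟨G, ⟨-, hG⟩, -⟩ := (AddCircle.isCoveringMap_coe (1 : ℝ)).existsUnique_continuousMap_lifts
    ⟨_, cg⟩ u (φ u) rfl
  have hG' : ∀ z, (G z : AddCircle (1 : ℝ)) = (φ z : AddCircle (1 : ℝ)) := fun z => congrFun hG z
  have hdisc : IsDiscrete ((AddSubgroup.zmultiples (1 : ℝ) : Set ℝ)) :=
    ⟨inferInstanceAs (DiscreteTopology (AddSubgroup.zmultiples (1 : ℝ)))⟩
  have key : ∀ a b : ℝ, (a : AddCircle (1 : ℝ)) = (b : AddCircle (1 : ℝ)) →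
      a - b ∈ (AddSubgroup.zmultiples (1 : ℝ) : Set ℝ) := by
    intro a b h
    have := (QuotientAddGroup.eq.1 h.symm)
    rwa [neg_add_eq_sub] at this
  have e1 : G u - φ u = G v - φ v := htL.constant_of_mapsTo (f := fun z => G z - φ z) hdisc
    (fun z hz => (G.continuous.continuousAt.sub (cφ z (tLs hz))).continuousWithinAt)
    (fun z _ => key _ _ (hG' z)) utL vtL
  have e2 : G u - ψ u = G v - ψ v := htK.constant_of_mapsTo (f := fun z => G z - ψ z) hdisc
    (fun z hz => (G.continuous.continuousAt.sub (cψ z (tKs hz))).continuousWithinAt)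
    (fun z _ => key _ _ ((hG' z).trans (hφψ z))) utK vtK
  simp only [hφ, hψ, indicator_of_mem huU, indicator_of_notMem hvU] at e1 e2
  linarith

section Normed
variable {E : Type*} [NormedAddCommGroup E] [NormedSpace ℝ E]

lemma isPreconnected_compl_closedBall_aux (hE : 1 < Module.rank ℝ E) (x : E) {r : ℝ}
    (hr : 0 ≤ r) : IsPreconnected (Metric.closedBall x r)ᶜ := by
  have h0 := (isConnected_compl_singleton_of_one_lt_rank hE (0 : E)).isPreconnected
  have hc : ContinuousOn (fun y : E => x + (1 + r / ‖y‖) • y) {0}ᶜ := by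
    have : ∀ y ∈ ({0}ᶜ : Set E), ‖y‖ ≠ 0 := fun y hy => norm_ne_zero_iff.2 hy
    fun_prop (disch := assumption)
  convert h0.image _ hc using 1
  ext z
  simp only [mem_compl_iff, Metric.mem_closedBall, not_le, mem_image, mem_singleton_iff,
    dist_eq_norm]
  constructor
  · intro hz
    have hw : 0 < ‖z - x‖ := hr.trans_lt hz
    have hp : 0 < 1 - r / ‖z - x‖ := by
      rw [sub_pos, div_lt_one hw]; exact hz
    refine ⟨(1 - r / ‖z - x‖) • (z - x), ?_, ?_⟩
    · exact smul_ne_zero hp.ne' (norm_pos_iff.1 hw)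
    · rw [norm_smul, Real.norm_of_nonneg hp.le, smul_smul]
      have : (1 + r / ((1 - r / ‖z - x‖) * ‖z - x‖)) * (1 - r / ‖z - x‖) = 1 := by
        have h2 : ‖z - x‖ - r ≠ 0 := by linarith
        field_simp
        ring
      rw [this]; simp
  · rintro ⟨y, hy, rfl⟩
    have hw : 0 < ‖y‖ := norm_pos_iff.2 hy
    have : 0 ≤ r / ‖y‖ := by positivity
    rw [add_sub_cancel_left, norm_smul, Real.norm_of_nonneg (by positivity)]
    field_simp
    linarith

/-- Relative clopen subsets of a closed set `Y` are small near every point. -/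
def SmallClopen {E : Type*} [TopologicalSpace E] (Y : Set E) : Prop :=
  ∀ x ∈ Y, ∀ U : Set E, IsOpen U → x ∈ U →
    ∃ W : Set E, W ⊆ Y ∧ IsClosed W ∧ IsClosed (Y \ W) ∧ x ∈ W ∧ W ⊆ U

lemma nonSep_of_smallClopen (hE : 1 < Module.rank ℝ E) {Y : Set E} (hY : IsClosed Y)
    (hYs : SmallClopen Y) {u v : E} (hu : u ∉ Y) (hv : v ∉ Y) : NonSep u v Y := by
  have h1 : ∀ x : E, ∃ W : Set E, x ∈ Y → W ⊆ Y ∧ IsClosed W ∧ IsClosed (Y \ W) ∧ x ∈ W ∧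
      NonSep u v W := by
    intro x
    by_cases hx : x ∈ Y
    swap
    · exact ⟨∅, fun h => absurd h hx⟩
    have hux : 0 < dist u x := dist_pos.2 (fun h => hu (h ▸ hx))
    have hvx : 0 < dist v x := dist_pos.2 (fun h => hv (h ▸ hx))
    obtain ⟨r, hr0, hr⟩ := exists_between (lt_min hux hvx)
    obtain ⟨W, hW1, hW2, hW3, hW4, hW5⟩ :=
      hYs x hx (Metric.ball x r) Metric.isOpen_ball (Metric.mem_ball_self hr0)
    refine ⟨W, fun _ => ⟨hW1, hW2, hW3, hW4, (Metric.closedBall x r)ᶜ,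
      isPreconnected_compl_closedBall_aux hE x hr0.le, ?_, ?_, ?_⟩⟩
    · simpa using hr.trans_le (min_le_left _ _)
    · simpa using hr.trans_le (min_le_right _ _)
    · exact compl_subset_compl.2 (hW5.trans Metric.ball_subset_closedBall)
  choose W hW using h1
  have hcpt : IsCompact (segment ℝ u v ∩ Y) := by
    refine IsCompact.inter_right ?_ hY
    rw [segment_eq_image_lineMap]
    exact isCompact_Icc.image AffineMap.lineMap_continuous
  have hopen : ∀ x : E, x ∈ Y → IsOpen (Y \ W x)ᶜ := fun x hx => (hW x hx).2.2.1.isOpen_compl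
  obtain ⟨s, hsY, hs⟩ := hcpt.elim_nhds_subcover (fun x => (Y \ W x)ᶜ)
    (fun x hx => (hopen x hx.2).mem_nhds (fun h => h.2 (hW x hx.2).2.2.2.1))
  have main : ∀ s : Finset E, (∀ x ∈ s, x ∈ Y) → NonSep u v (Y \ ⋃ x ∈ s, W x) →
      NonSep u v Y := by
    intro s
    induction s using Finset.cons_induction with
    | empty => intro _ h; simpa using h
    | cons a s ha ih =>
      intro hs h
      have haY : a ∈ Y := hs a (Finset.mem_cons_self a s)
      have hsY : ∀ x ∈ s, x ∈ Y := fun x hx => hs x (Finset.mem_cons_of_mem hx)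
      have hclosed : ∀ t : Finset E, (∀ x ∈ t, x ∈ Y) → IsClosed (Y \ ⋃ x ∈ t, W x) := by
        intro t ht
        have : (Y \ ⋃ x ∈ t, W x) = Y ∩ ⋂ x ∈ t, (Y \ W x) := by
          ext z
          simp only [Set.mem_sdiff, mem_iUnion, mem_inter_iff, mem_iInter]
          grind
        rw [this]
        exact hY.inter (isClosed_biInter fun x hx => (hW x (ht x hx)).2.2.1)
      apply ih hsY
      have heq : (Y \ ⋃ x ∈ s, W x) =
          ((Y \ ⋃ x ∈ s, W x) ∩ W a) ∪ (Y \ ⋃ x ∈ Finset.cons a s ha, W x) := by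
        ext z
        simp only [Set.mem_sdiff, mem_iUnion, mem_inter_iff, mem_union, Finset.mem_cons]
        grind
      rw [heq]
      refine janiszewski ((hclosed s hsY).inter (hW a haY).2.1) (hclosed _ hs) ?_ ?_ h
      · rw [Set.disjoint_left]
        rintro z ⟨_, hz⟩ ⟨_, hz'⟩
        exact hz' (mem_biUnion (Finset.mem_cons_self a s) hz)
      · obtain ⟨t, ht, hut, hvt, hts⟩ := (hW a haY).2.2.2.2
        exact ⟨t, ht, hut, hvt, hts.trans (compl_subset_compl.2 inter_subset_right)⟩
  refine main s (fun x hx => (hsY x hx).2) ⟨segment ℝ u v, (convex_segment u v).isPreconnected,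
    left_mem_segment ℝ u v, right_mem_segment ℝ u v, ?_⟩
  intro z hz hz'
  obtain ⟨x, hx, hzx⟩ := mem_iUnion₂.1 (hs ⟨hz, hz'.1⟩)
  exact hzx ⟨hz'.1, fun h => hz'.2 (mem_biUnion hx h)⟩

lemma isPreconnected_compl_of_smallClopen (hE : 1 < Module.rank ℝ E) {Y : Set E}
    (hY : IsClosed Y) (hYs : SmallClopen Y) : IsPreconnected Yᶜ := by
  refine isPreconnected_of_forall_pair fun u hu v hv => ?_
  obtain ⟨t, ht, hut, hvt, hts⟩ := nonSep_of_smallClopen hE hY hYs hu hv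
  exact ⟨t, hts, hut, hvt, ht⟩

lemma dense_compl_of_smallClopen (hE : 1 < Module.rank ℝ E) {Y : Set E}
    (hYs : SmallClopen Y) : Dense Yᶜ := by
  have : Nontrivial E := (rank_pos_iff_nontrivial (R := ℝ)).1 (zero_lt_one.trans hE)
  rw [← interior_eq_empty_iff_dense_compl, eq_empty_iff_forall_notMem]
  intro x hx
  obtain ⟨r, hr, hxr⟩ := Metric.isOpen_iff.1 isOpen_interior x hx
  obtain ⟨W, hW1, hW2, hW3, hW4, hW5⟩ := hYs x (interior_subset hx) (Metric.ball x r)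
    Metric.isOpen_ball (Metric.mem_ball_self hr)
  have hWo : IsOpen W := by
    have : W = Metric.ball x r ∩ (Y \ W)ᶜ := by
      ext z
      constructor
      · exact fun hz => ⟨hW5 hz, fun h => h.2 hz⟩
      · rintro ⟨hz, hz'⟩
        by_contra hzW
        exact hz' ⟨interior_subset (hxr hz), hzW⟩
    rw [this]
    exact Metric.isOpen_ball.inter hW3.isOpen_compl
  have hWu : W = univ := IsClopen.eq_univ ⟨hW2, hWo⟩ ⟨x, hW4⟩
  obtain ⟨y, hy⟩ := NormedSpace.exists_lt_norm ℝ E r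
  have : x + y ∈ Metric.ball x r := hW5 (hWu ▸ mem_univ _)
  rw [Metric.mem_ball, dist_eq_norm, add_sub_cancel_left] at this
  linarith

end Normed

lemma smallClopen_preimage {E M : Type} [TopologicalSpace E] [TopologicalSpace M] {e : E → M}
    (he : IsOpenEmbedding e) {X : Set M} (hX : IsClosed X) (hd : HasDimensionZero X) :
    SmallClopen (e ⁻¹' X) := by
  intro x hx U hU hxU
  obtain ⟨V, hVo, hVc, hxV, hVU⟩ := hd ⟨e x, hx⟩ (Subtype.val ⁻¹' (e '' U))
    ((he.isOpenMap U hU).preimage continuous_subtype_val) ⟨x, hxU, rfl⟩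
  refine ⟨e ⁻¹' (Subtype.val '' V), ?_, ?_, ?_, ?_, ?_⟩
  · exact preimage_mono (Subtype.coe_image_subset X V)
  · exact (hX.isClosedEmbedding_subtypeVal.isClosedMap V hVc).preimage he.continuous
  · have : (e ⁻¹' X \ e ⁻¹' (Subtype.val '' V)) = e ⁻¹' (Subtype.val '' Vᶜ) := by
      ext z
      simp
    rw [this]
    exact (hX.isClosedEmbedding_subtypeVal.isClosedMap _ hVo.isClosed_compl).preimage he.continuous
  · exact ⟨_, hxV, rfl⟩
  · rintro z ⟨w, hw, hwz⟩
    obtain ⟨y, hy, hyw⟩ := hVU hw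
    have : y = z := he.injective (hyw.trans hwz)
    exact this ▸ hy

lemma exists_chart {n : ℕ} {M : Type} [TopologicalSpace M] (hM : IsLocallyEuclidean n M) (m : M) :
    ∃ e : EuclideanSpace ℝ (Fin n) → M, IsOpenEmbedding e ∧ m ∈ range e := by
  obtain ⟨U, V, hmU, hU, hV, ⟨φ⟩⟩ := hM m
  set c := φ ⟨m, hmU⟩ with hc
  obtain ⟨r, hr, hrV⟩ := Metric.isOpen_iff.1 hV c c.2
  have h1 : IsOpenEmbedding (OpenPartialHomeomorph.univBall (c : EuclideanSpace ℝ (Fin n)) r) :=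
    OpenPartialHomeomorph.isOpenEmbedding _ (OpenPartialHomeomorph.univBall_source _ _)
  have hmem : ∀ y, OpenPartialHomeomorph.univBall (c : EuclideanSpace ℝ (Fin n)) r y ∈ V := by
    intro y
    apply hrV
    rw [← OpenPartialHomeomorph.univBall_target _ hr]
    exact OpenPartialHomeomorph.map_source _ (by simp)
  have h2 : IsOpenEmbedding (fun y => (⟨_, hmem y⟩ : V)) :=
    IsOpenEmbedding.of_comp _ hV.isOpenEmbedding_subtypeVal h1
  refine ⟨_, hU.isOpenEmbedding_subtypeVal.comp (φ.symm.isOpenEmbedding.comp h2), 0, ?_⟩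
  have : (⟨_, hmem 0⟩ : V) = c := Subtype.ext (by simp)
  simp only [Function.comp]
  rw [this, hc]
  simp

lemma exists_good_nhd {n : ℕ} (hn : 2 ≤ n) {M : Type} [TopologicalSpace M]
    (hM : IsLocallyEuclidean n M) {X : Set M} (hX : IsClosed X) (hd : HasDimensionZero X) (m : M) :
    ∃ O : Set M, IsOpen O ∧ m ∈ O ∧ IsPreconnected O ∧ IsPreconnected (O ∩ Xᶜ) ∧
      O ⊆ closure (O ∩ Xᶜ) := by
  obtain ⟨e, he, hm⟩ := exists_chart hM m
  have hE : 1 < Module.rank ℝ (EuclideanSpace ℝ (Fin n)) := by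
    rw [← Module.finrank_eq_rank, finrank_euclideanSpace_fin]
    exact_mod_cast hn
  have hs := smallClopen_preimage he hX hd
  have h1 := isPreconnected_compl_of_smallClopen hE (hX.preimage he.continuous) hs
  have h2 := dense_compl_of_smallClopen hE hs
  have heq : range e ∩ Xᶜ = e '' (e ⁻¹' X)ᶜ := by
    rw [← preimage_compl, image_preimage_eq_inter_range, inter_comm]
  refine ⟨range e, he.isOpen_range, hm, isPreconnected_range he.continuous, ?_, ?_⟩
  · rw [heq]; exact h1.image _ he.continuous.continuousOn
  · rw [heq]
    rintro _ ⟨y, rfl⟩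
    exact image_closure_subset_closure_image he.continuous ⟨y, h2 y, rfl⟩

/-- **Lemma 3.11 of Pardon**. If `M` is a manifold of dimension `n ≥ 2` and `X ⊆ M` is a
closed subset of dimension zero, then the inclusion `M ∖ X → M` induces a bijection on
connected components (equivalently, an isomorphism `H₀(M ∖ X; ℤ) → H₀(M; ℤ)`). -/
theorem compl_of_dimension_zero_closed_set_components (n : ℕ) (hn : 2 ≤ n) (M : Type)
    [TopologicalSpace M] [T2Space M] (hM : IsLocallyEuclidean n M) (X : Set M)
    (hX_closed : IsClosed X) (hX_dim : HasDimensionZero X) :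
    Function.Bijective (complComponentsMap M X) := by
  have good := exists_good_nhd hn hM hX_closed hX_dim
  have hmk : ∀ p : (Xᶜ : Set M), complComponentsMap M X (ConnectedComponents.mk p) =
      ConnectedComponents.mk (p : M) := fun p => rfl
  constructor
  · intro a b hab
    obtain ⟨p, rfl⟩ := ConnectedComponents.surjective_coe a
    obtain ⟨q, rfl⟩ := ConnectedComponents.surjective_coe b
    rw [hmk, hmk, ConnectedComponents.coe_eq_coe] at hab
    set A := connectedComponentIn Xᶜ (p : M) with hA
    have hpA : (p : M) ∈ A := mem_connectedComponentIn p.2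
    have step : ∀ m ∈ closure A, ∃ O : Set M, IsOpen O ∧ m ∈ O ∧ O ∩ Xᶜ ⊆ A ∧
        O ⊆ closure A := by
      intro m hm
      obtain ⟨O, hO, hmO, -, hOX, hOc⟩ := good m
      obtain ⟨z, hzO, hzA⟩ := mem_closure_iff.1 hm O hO hmO
      have hzX : z ∈ Xᶜ := connectedComponentIn_subset _ _ hzA
      have hsub : O ∩ Xᶜ ⊆ A := by
        rw [hA, connectedComponentIn_eq hzA]
        exact hOX.subset_connectedComponentIn ⟨hzO, hzX⟩ inter_subset_right
      exact ⟨O, hO, hmO, hsub, hOc.trans (closure_mono hsub)⟩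
    have hclopen : IsClopen (closure A) := by
      refine ⟨isClosed_closure, isOpen_iff_mem_nhds.2 fun m hm => ?_⟩
      obtain ⟨O, hO, hmO, -, hOc⟩ := step m hm
      exact mem_of_superset (hO.mem_nhds hmO) hOc
    have hq : (q : M) ∈ closure A := by
      apply hclopen.connectedComponent_subset (subset_closure hpA)
      rw [hab]
      exact mem_connectedComponent
    obtain ⟨O, -, hqO, hOA, -⟩ := step q hq
    have hqA : (q : M) ∈ A := hOA ⟨hqO, q.2⟩
    rw [ConnectedComponents.coe_eq_coe']
    rw [hA, connectedComponentIn_eq_image p.2] at hqA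
    obtain ⟨w, hw, hwq⟩ := hqA
    have : w = q := Subtype.ext hwq
    rw [← this]
    first
      | exact hw
      | exact connectedComponent_eq hw ▸ mem_connectedComponent
  · intro b
    obtain ⟨m, rfl⟩ := ConnectedComponents.surjective_coe b
    obtain ⟨O, hO, hmO, hOp, -, hOc⟩ := good m
    obtain ⟨z, hz, hzX⟩ := closure_nonempty_iff.1 ⟨m, hOc hmO⟩
    refine ⟨ConnectedComponents.mk ⟨z, hzX⟩, ?_⟩
    rw [hmk, ConnectedComponents.coe_eq_coe']
    exact hOp.subset_connectedComponent hmO hz
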